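/- Let F be a field with char F ≠ 2 and let n ≥ 1. Let α be an integer with 1 ≤ α ≤ n, and assume that if α < n then the group F^×/(F^×)^2 is finite. Let (1^n) denote the sequence (1, 1, …, 1) of length n, so that M_{(1^n)} is the variety of full isotropic flags V_1 ⊆ ⋯ ⊆ V_n with dim V_i = i and V_n isotropic. Then the set of G-orbits on the triple flag variety M_{(α)} × M_{(1)} × M_{(1^n)} under the diagonal action of G = O_{2n+1}(F) is finite. -/

import Mathlib

open Module

/-- The symmetric bilinear form on `F^N` given by `(e_i, e_j) = δ_{i, N+1-j}`
(in 1-indexed notation), i.e. `(u, v) = ∑ i, u i * v (rev i)`. -/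
def bform (F : Type*) [Field F] (N : ℕ) (u v : Fin N → F) : F :=
  ∑ i, u i * v i.rev

/-- `g` belongs to the split orthogonal group `O_N(F)`. -/
def IsOrthMap (F : Type*) [Field F] (N : ℕ)
    (g : (Fin N → F) ≃ₗ[F] (Fin N → F)) : Prop :=
  ∀ u v, bform F N (g u) (g v) = bform F N u v

/-- A subspace `V` is isotropic if `(V, V) = {0}`. -/
def IsIsotropic (F : Type*) [Field F] (N : ℕ) (V : Submodule F (Fin N → F)) : Prop :=
  ∀ u ∈ V, ∀ v ∈ V, bform F N u v = 0

/-- A flag of type `a = (a 0, …, a (p-1))` in `F^{2n+1}` : an increasing chain of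
subspaces `V 0 ⊆ ⋯ ⊆ V (p-1)` with `dim (V i) = a 0 + ⋯ + a i` which is isotropic
(equivalently, by monotonicity, whose top member is isotropic). -/
def IsFlag (F : Type*) [Field F] (n p : ℕ) (a : Fin p → ℕ)
    (V : Fin p → Submodule F (Fin (2*n+1) → F)) : Prop :=
  Monotone V ∧ (∀ i : Fin p, finrank F (V i) = ∑ j ∈ Finset.Iic i, a j) ∧
    ∀ i : Fin p, IsIsotropic F (2*n+1) (V i)

/-- The flag variety `M_a`. -/
def FlagVar (F : Type*) [Field F] (n p : ℕ) (a : Fin p → ℕ) :=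
  { V : Fin p → Submodule F (Fin (2*n+1) → F) // IsFlag F n p a V }

/-- The orbit relation of the diagonal action of `O_{2n+1}(F)` on the triple flag
variety `M_a × M_b × M_c`. -/
def TripleRel (F : Type*) [Field F] (n p q r : ℕ)
    (a : Fin p → ℕ) (b : Fin q → ℕ) (c : Fin r → ℕ)
    (x y : FlagVar F n p a × FlagVar F n q b × FlagVar F n r c) : Prop :=
  ∃ g : (Fin (2*n+1) → F) ≃ₗ[F] (Fin (2*n+1) → F), IsOrthMap F (2*n+1) g ∧
    (∀ i, Submodule.map g.toLinearMap (x.1.1 i) = y.1.1 i) ∧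
    (∀ i, Submodule.map g.toLinearMap (x.2.1.1 i) = y.2.1.1 i) ∧
    (∀ i, Submodule.map g.toLinearMap (x.2.2.1 i) = y.2.2.1 i)


section OrthogonalOrbits

variable {F : Type*} [Field F] {N : ℕ}

theorem bform_comm (u v : Fin N → F) : bform F N u v = bform F N v u := by
  unfold bform
  rw [← Equiv.sum_comp Fin.revPerm]
  exact Finset.sum_congr rfl fun i _ => by simp [mul_comm]

theorem bform_add_left (u u' v : Fin N → F) :
    bform F N (u + u') v = bform F N u v + bform F N u' v := by
  simp [bform, add_mul, Finset.sum_add_distrib]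

theorem bform_sub_left (u u' v : Fin N → F) :
    bform F N (u - u') v = bform F N u v - bform F N u' v := by
  simp [bform, sub_mul, Finset.sum_sub_distrib]

theorem bform_smul_left (c : F) (u v : Fin N → F) :
    bform F N (c • u) v = c * bform F N u v := by
  simp [bform, mul_assoc, Finset.mul_sum]

theorem bform_add_right (u v v' : Fin N → F) :
    bform F N u (v + v') = bform F N u v + bform F N u v' := by
  simp [bform, mul_add, Finset.sum_add_distrib]

theorem bform_sub_right (u v v' : Fin N → F) :
    bform F N u (v - v') = bform F N u v - bform F N u v' := by
  simp [bform, mul_sub, Finset.sum_sub_distrib]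

theorem bform_smul_right (c : F) (u v : Fin N → F) :
    bform F N u (c • v) = c * bform F N u v := by
  rw [bform_comm, bform_smul_left, bform_comm]

theorem bform_single_right (u : Fin N → F) (k : Fin N) :
    bform F N u (Pi.single k 1) = u k.rev := by
  unfold bform
  rw [Finset.sum_eq_single k.rev]
  · simp
  · intro i _ hi
    have : i.rev ≠ k := fun h => hi (by rw [← h, Fin.rev_rev])
    simp [this]
  · simp

theorem bform_single_left (u : Fin N → F) (k : Fin N) :
    bform F N (Pi.single k 1) u = u k.rev := by
  rw [bform_comm, bform_single_right]

theorem eq_of_rev_eq_self {i j : Fin N} (hi : i = i.rev) (hj : j = j.rev) : i = j := by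
  have h1 := congrArg Fin.val hi
  have h2 := congrArg Fin.val hj
  rw [Fin.val_rev] at h1 h2
  ext
  omega

theorem IsOrthMap.trans {g h : (Fin N → F) ≃ₗ[F] (Fin N → F)} (hg : IsOrthMap F N g)
    (hh : IsOrthMap F N h) : IsOrthMap F N (g.trans h) := fun u v => by
  simp [hh _ _, hg _ _]

theorem IsOrthMap.symm {g : (Fin N → F) ≃ₗ[F] (Fin N → F)} (hg : IsOrthMap F N g) :
    IsOrthMap F N g.symm := fun u v => by
  rw [← hg]; simp

theorem IsIsotropic.map {g : (Fin N → F) ≃ₗ[F] (Fin N → F)} (hg : IsOrthMap F N g)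
    {W : Submodule F (Fin N → F)} (hW : IsIsotropic F N W) :
    IsIsotropic F N (W.map g.toLinearMap) := by
  rintro _ ⟨u, hu, rfl⟩ _ ⟨v, hv, rfl⟩
  exact (hg u v).trans (hW u hu v hv)

/-- A linear endomorphism preserving the form is automatically invertible. -/
theorem exists_orthMap_of_linearMap (f : (Fin N → F) →ₗ[F] (Fin N → F))
    (hf : ∀ u v, bform F N (f u) (f v) = bform F N u v) :
    ∃ g : (Fin N → F) ≃ₗ[F] (Fin N → F), IsOrthMap F N g ∧ ∀ x, g x = f x := by
  have hinj : Function.Injective f := by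
    rw [injective_iff_map_eq_zero]
    intro x hx
    ext i
    have := hf x (Pi.single i.rev 1)
    rw [hx, bform_single_right, Fin.rev_rev] at this
    simpa [bform] using this.symm
  exact ⟨LinearEquiv.ofInjectiveEndo f hinj, fun u v => hf u v, fun x => rfl⟩

/-- The Siegel (Eichler) transformation attached to an isotropic vector `a` and a vector `b`
orthogonal to `a`. -/
theorem exists_siegel (h2 : (2 : F) ≠ 0) (a b : Fin N → F) (ha : bform F N a a = 0)
    (hab : bform F N b a = 0) :
    ∃ g : (Fin N → F) ≃ₗ[F] (Fin N → F), IsOrthMap F N g ∧ ∀ x,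
      g x = x + (bform F N x b - bform F N b b / 2 * bform F N x a) • a
        - bform F N x a • b := by
  refine exists_orthMap_of_linearMap
    { toFun := fun x => x + (bform F N x b - bform F N b b / 2 * bform F N x a) • a
        - bform F N x a • b
      map_add' := fun x y => ?_
      map_smul' := fun c x => ?_ } fun u v => ?_
  · simp only [bform_add_left]
    module
  · simp only [bform_smul_left, RingHom.id_apply]
    module
  · simp only [LinearMap.coe_mk, AddHom.coe_mk, bform_add_left, bform_add_right, bform_sub_left,
      bform_sub_right, bform_smul_left, bform_smul_right, ha, hab, bform_comm a b,
      bform_comm a v, bform_comm b v]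
    field_simp
    ring

/-- `g` is upper triangular: it preserves the span of each initial segment of the basis. -/
def IsUpper (g : (Fin N → F) ≃ₗ[F] (Fin N → F)) : Prop :=
  ∀ (m : Fin N) (x : Fin N → F), (∀ i, m < i → x i = 0) → ∀ i, m < i → g x i = 0

theorem IsUpper.trans {g h : (Fin N → F) ≃ₗ[F] (Fin N → F)} (hg : IsUpper g)
    (hh : IsUpper h) : IsUpper (g.trans h) := fun m x hx => hh m _ (hg m x hx)

/-- The span of the basis vectors indexed by `T`. -/
def coordSub (F : Type*) [Field F] {N : ℕ} (T : Set (Fin N)) : Submodule F (Fin N → F) where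
  carrier := {x | ∀ i, i ∉ T → x i = 0}
  add_mem' := fun {x y} hx hy i hi => by simp [hx i hi, hy i hi]
  zero_mem' := fun _ _ => rfl
  smul_mem' := fun c x hx i hi => by simp [hx i hi]

theorem map_coordSub_eq {T : Set (Fin N)} {g : (Fin N → F) ≃ₗ[F] (Fin N → F)}
    (h : ∀ x ∈ coordSub F T, g x ∈ coordSub F T) :
    (coordSub F T).map g.toLinearMap = coordSub F T := by
  refine Submodule.eq_of_le_of_finrank_eq ?_ (LinearEquiv.finrank_map_eq g _)
  rintro _ ⟨x, hx, rfl⟩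
  exact h x hx

theorem IsUpper.map_coordSub_Iic {g : (Fin N → F) ≃ₗ[F] (Fin N → F)} (hg : IsUpper g)
    (m : Fin N) : (coordSub F (Set.Iic m)).map g.toLinearMap = coordSub F (Set.Iic m) := by
  refine map_coordSub_eq fun x hx i hi => hg m x (fun j hj => hx j ?_) i ?_
  · simpa using hj
  · simpa using hi

theorem eq_coordSub {W : Submodule F (Fin N → F)} {T : Finset (Fin N)}
    (hT : ∀ s ∈ T, Pi.single s 1 ∈ W) (hW : finrank F W = T.card) :
    W = coordSub F (T : Set (Fin N)) := by
  have hle : Submodule.span F (Set.range fun s : T => (Pi.single s.1 1 : Fin N → F)) ≤ W := by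
    rw [Submodule.span_le]
    rintro _ ⟨s, rfl⟩
    exact hT s.1 s.2
  have hli : LinearIndependent F fun s : T => (Pi.single s.1 1 : Fin N → F) :=
    (Pi.linearIndependent_single_one (Fin N) F).comp _ Subtype.val_injective
  have heq := Submodule.eq_of_le_of_finrank_eq hle (by
    rw [finrank_span_eq_card hli, hW, Fintype.card_coe])
  apply le_antisymm
  · rw [← heq, Submodule.span_le]
    rintro _ ⟨s, rfl⟩ i hi
    have : i ≠ s.1 := fun h => hi (h ▸ s.2)
    simp [this]
  · intro x hx
    rw [pi_eq_sum_univ' x]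
    refine W.sum_mem fun i _ => ?_
    by_cases hi : i ∈ T
    · refine W.smul_mem _ ?_
      convert hT i hi using 1
    · rw [hx i (by simpa using hi)]
      simp

theorem exists_mem_ne_zero_of_card_lt {W : Submodule F (Fin N → F)} {T : Finset (Fin N)}
    (hW : T.card < finrank F W) : ∃ u ∈ W, u ≠ 0 ∧ ∀ s ∈ T, u s = 0 := by
  let f : W →ₗ[F] (T → F) :=
    (LinearMap.pi fun s : T => LinearMap.proj s.1) ∘ₗ W.subtype
  have hker : LinearMap.ker f ≠ ⊥ := LinearMap.ker_ne_bot_of_finrank_lt (by simpa using hW)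
  obtain ⟨u, hu, hu0⟩ := Submodule.exists_mem_ne_zero_of_ne_bot hker
  refine ⟨u.1, u.2, fun h => hu0 (Subtype.ext h), fun s hs => ?_⟩
  exact congrFun (LinearMap.mem_ker.1 hu) ⟨s, hs⟩

theorem IsIsotropic.apply_rev_eq_zero {W : Submodule F (Fin N → F)} (hW : IsIsotropic F N W)
    {u : Fin N → F} (hu : u ∈ W) {s : Fin N} (hs : Pi.single s 1 ∈ W) : u s.rev = 0 := by
  rw [← bform_single_right u s]
  exact hW _ hu _ hs

/-- An isotropic vector `u` with `u k ≠ 0` can be moved to a multiple of the `k`-th basis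
vector, without moving the basis vectors orthogonal to `u`. -/
theorem exists_orthMap_apply_eq_single (h2 : (2 : F) ≠ 0) {u : Fin N → F}
    (hu : bform F N u u = 0) {k : Fin N} (hk : k ≠ k.rev) (huk : u k ≠ 0) :
    ∃ g : (Fin N → F) ≃ₗ[F] (Fin N → F), IsOrthMap F N g ∧ g u = u k • Pi.single k 1 ∧
      (∀ s, u s.rev = 0 → s ≠ k → g (Pi.single s 1) = Pi.single s 1) ∧
      ((∀ i, k < i → u i = 0) → IsUpper g) := by
  set a : Fin N → F := Pi.single k.rev 1 with ha
  set b : Fin N → F := (u k)⁻¹ • u - Pi.single k 1 - ((u k)⁻¹ * u k.rev) • a with hb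
  have hxa : ∀ x, bform F N x a = x k := fun x => by rw [ha, bform_single_right, Fin.rev_rev]
  have hak : a k = 0 := by simp [ha, hk]
  have hbk : b k = 0 := by simp [hb, hak, huk]
  have hbrk : b k.rev = 0 := by simp [hb, ha, hk.symm]
  have hub : bform F N u b = - 2 * u k.rev := by
    rw [hb, bform_sub_right, bform_sub_right, bform_smul_right, bform_smul_right, hu, hxa,
      bform_single_right]
    field_simp
    ring
  have hbb : bform F N b b = - 2 * u k.rev * (u k)⁻¹ := by
    nth_rewrite 1 [hb]
    rw [bform_sub_left, bform_sub_left, bform_smul_left, bform_smul_left, hub,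
      bform_single_left, bform_comm, hxa, hbk, hbrk]
    ring
  have hbi : ∀ i, i ≠ k → i ≠ k.rev → b i = (u k)⁻¹ * u i := fun i h1 h2 => by
    simp [hb, ha, h1, h2]
  obtain ⟨g, hg, hgx⟩ := exists_siegel h2 a b (by rw [hxa, hak]) (by rw [hxa, hbk])
  refine ⟨g, hg, ?_, fun s hs hsk => ?_, fun hupper m x hx i hi => ?_⟩
  · rw [hgx, hxa, hub, hbb, hb]
    ext i
    simp only [Pi.add_apply, Pi.sub_apply, Pi.smul_apply, smul_eq_mul]
    field_simp
    ring
  · have h1 : s.rev ≠ k := fun h => huk (h ▸ hs)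
    have h3 : s.rev ≠ k.rev := fun h => hsk (Fin.rev_injective h)
    rw [hgx, hxa, bform_single_left, hbi _ h1 h3, hs]
    simp [hsk.symm]
  · have hbz : ∀ j, k ≤ j → b j = 0 := by
      intro j hj
      rcases hj.eq_or_lt with rfl | hj
      · exact hbk
      · by_cases hjr : j = k.rev
        · rw [hjr, hbrk]
        · rw [hbi j hj.ne' hjr, hupper j hj, mul_zero]
    have hterm : x k * b i = 0 := by
      rcases lt_or_ge m k with h | h
      · rw [hx k h, zero_mul]
      · rw [hbz i (h.trans hi.le), mul_zero]
    rw [hgx, hxa]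
    simp only [Pi.add_apply, Pi.sub_apply, Pi.smul_apply, smul_eq_mul, hx i hi, hterm]
    by_cases hik : i = k.rev
    · subst hik
      have hxb : bform F N x b = 0 := by
        refine Finset.sum_eq_zero fun j _ => ?_
        rcases lt_or_ge m j with h | h
        · rw [hx j h, zero_mul]
        · rw [hbz j.rev, mul_zero]
          rw [← Fin.rev_le_rev, Fin.rev_rev]
          exact h.trans hi.le
      have hbbx : bform F N b b * x k = 0 := by
        rcases lt_or_ge m k with h | h
        · rw [hx k h, mul_zero]
        · have : bform F N b b = 0 := by
            refine Finset.sum_eq_zero fun j _ => ?_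
            rcases lt_or_ge j k with hj | hj
            · rw [hbz j.rev, mul_zero]
              exact (h.trans hi.le).trans (Fin.rev_lt_rev.2 hj).le
            · rw [hbz j hj, zero_mul]
          rw [this, zero_mul]
      rw [hxb]
      linear_combination (- a k.rev / 2) * hbbx
    · simp [ha, hik]

theorem exists_apply_ne_zero_of_isotropic {u : Fin N → F} (hu : bform F N u u = 0)
    (hu0 : u ≠ 0) : ∃ j, j ≠ j.rev ∧ u j ≠ 0 := by
  by_contra! h
  obtain ⟨j, hj⟩ := Function.ne_iff.1 hu0
  have hjr : j = j.rev := by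
    by_contra h'
    exact hj (h j h')
  refine hj (pow_eq_zero_iff two_ne_zero |>.1 (Eq.trans ?_ hu))
  unfold bform
  rw [Finset.sum_eq_single j, ← hjr, sq]
  · intro i _ hij
    rw [h i (fun hi => hij (eq_of_rev_eq_self hi hjr)), zero_mul]
  · simp

theorem ne_rev_of_isotropic_of_top {u : Fin N → F} (hu : bform F N u u = 0) {k : Fin N}
    (hk : u k ≠ 0) (htop : ∀ i, k < i → u i = 0) : k ≠ k.rev := by
  intro hkr
  refine hk (pow_eq_zero_iff two_ne_zero |>.1 (Eq.trans ?_ hu))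
  unfold bform
  rw [Finset.sum_eq_single k, ← hkr, sq]
  · intro i _ hik
    rcases lt_or_gt_of_ne hik with h | h
    · rw [htop i.rev, mul_zero]
      rw [hkr]
      exact Fin.rev_lt_rev.2 h
    · rw [htop i h, zero_mul]
  · simp

/-- An isotropic subspace can be moved to a coordinate subspace by an upper triangular
orthogonal map. -/
theorem exists_isUpper_map_eq_coordSub (h2 : (2 : F) ≠ 0) {U : Submodule F (Fin N → F)}
    (hU : IsIsotropic F N U) : ∃ (g : (Fin N → F) ≃ₗ[F] (Fin N → F)) (T : Finset (Fin N)),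
      IsOrthMap F N g ∧ IsUpper g ∧ T.card = finrank F U ∧
      U.map g.toLinearMap = coordSub F (T : Set (Fin N)) := by
  have key : ∀ m ≤ finrank F U, ∃ (g : (Fin N → F) ≃ₗ[F] (Fin N → F)) (T : Finset (Fin N)),
      IsOrthMap F N g ∧ IsUpper g ∧ T.card = m ∧
      ∀ s ∈ T, Pi.single s 1 ∈ U.map g.toLinearMap := by
    intro m
    induction m with
    | zero =>
      exact fun _ => ⟨LinearEquiv.refl F _, ∅, fun _ _ => rfl, fun _ _ hx => hx, rfl, by simp⟩
    | succ m ih =>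
      intro hm
      obtain ⟨g, T, hg, hgu, hT, hTU⟩ := ih (by omega)
      have hW := hU.map hg
      obtain ⟨u, huW, hu0, hus⟩ := exists_mem_ne_zero_of_card_lt (T := T)
        (W := U.map g.toLinearMap) (by rw [LinearEquiv.finrank_map_eq]; omega)
      classical
      obtain ⟨j, hj⟩ := Function.ne_iff.1 hu0
      obtain ⟨k, hk, hkmax⟩ := (Finset.univ.filter fun i => u i ≠ 0).exists_max_image id
        ⟨j, by simpa using hj⟩
      have hk0 : u k ≠ 0 := by simpa using hk
      have htop : ∀ i, k < i → u i = 0 := by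
        intro i hi
        by_contra h
        exact absurd (hkmax i (by simpa using h)) (not_le.2 hi)
      have huu := hW u huW u huW
      obtain ⟨h, hh, hhu, hhs, hhup⟩ := exists_orthMap_apply_eq_single h2 huu
        (ne_rev_of_isotropic_of_top huu hk0 htop) hk0
      have hkT : k ∉ T := fun h => hk0 (hus k h)
      refine ⟨g.trans h, insert k T, hg.trans hh, hgu.trans (hhup htop), ?_, ?_⟩
      · rw [Finset.card_insert_of_notMem hkT, hT]
      · have hmap : U.map (g.trans h).toLinearMap
            = (U.map g.toLinearMap).map h.toLinearMap := by
          rw [← Submodule.map_comp]; rfl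
        intro s hs
        rw [hmap]
        rcases Finset.mem_insert.1 hs with rfl | hsT
        · refine ⟨(u s)⁻¹ • u, Submodule.smul_mem _ _ huW, ?_⟩
          simp [hhu, smul_smul, hk0]
        · refine ⟨_, hTU s hsT, hhs s (hW.apply_rev_eq_zero huW (hTU s hsT)) ?_⟩
          rintro rfl
          exact hkT hsT
  obtain ⟨g, T, hg, hgu, hT, hTU⟩ := key _ le_rfl
  exact ⟨g, T, hg, hgu, hT, eq_coordSub hTU (by rw [LinearEquiv.finrank_map_eq, hT])⟩

/-- An isotropic vector can be moved to one whose `k`-th coordinate is nonzero, without moving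
the basis vectors orthogonal to both it and the hyperbolic plane of the `k`-th basis vector. -/
theorem exists_orthMap_apply_ne_zero (h2 : (2 : F) ≠ 0) {mid : Fin N} (hmid : mid = mid.rev)
    {u : Fin N → F} (hu : bform F N u u = 0) (hu0 : u ≠ 0) {k : Fin N} (hk : k ≠ k.rev) :
    ∃ g : (Fin N → F) ≃ₗ[F] (Fin N → F), IsOrthMap F N g ∧ g u k ≠ 0 ∧
      ∀ s, u s = 0 → s ≠ k → s ≠ k.rev → s ≠ mid →
        g (Pi.single s 1) = Pi.single s 1 := by
  by_cases huk : u k = 0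
  swap
  · exact ⟨LinearEquiv.refl F _, fun _ _ => rfl, huk, fun _ _ _ _ _ => rfl⟩
  have hkm : k ≠ mid := fun h => hk (by rw [h, ← hmid])
  by_cases hukr : u k.rev = 0
  · obtain ⟨j, hj, huj⟩ := exists_apply_ne_zero_of_isotropic hu hu0
    have hjk : j ≠ k := fun h => huj (h ▸ huk)
    have hjkr : j ≠ k.rev := fun h => huj (h ▸ hukr)
    obtain ⟨g, hg, hgx⟩ := exists_siegel h2 (Pi.single j.rev 1) (Pi.single k 1 : Fin N → F)
      (by rw [bform_single_right]; simp [hj])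
      (by rw [bform_single_right]; simp [hjk])
    refine ⟨g, hg, ?_, fun s hs hsk hskr hsm => ?_⟩
    · have : k ≠ j.rev := fun h => hjkr (by rw [h, Fin.rev_rev])
      rw [hgx]
      simp [bform_single_right, huk, this, huj]
    · have h1 : j ≠ s := fun h => huj (h ▸ hs)
      rw [hgx]
      simp [bform_single_right, h1, hskr.symm]
  · have hc : ∃ c : F, c * u mid - c * c / 2 * u k.rev ≠ 0 := by
      by_contra! h
      have h1 := h 1
      have h3 := h (-1)
      refine hukr (mul_left_cancel₀ h2 ?_)
      field_simp at h1 h3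
      linear_combination -h1 - h3
    obtain ⟨c, hc⟩ := hc
    have hmk : mid ≠ k.rev := fun h => hkm (by rw [hmid, h, Fin.rev_rev])
    obtain ⟨g, hg, hgx⟩ := exists_siegel h2 (Pi.single k 1) (c • Pi.single mid 1 : Fin N → F)
      (by rw [bform_single_right]; simp [hk.symm])
      (by rw [bform_single_right]; simp [hmk.symm])
    refine ⟨g, hg, ?_, fun s hs hsk hskr hsm => ?_⟩
    · rw [hgx]
      simpa [bform_single_right, bform_smul_right, bform_smul_left, huk, hkm, ← hmid] using hc
    · rw [hgx]
      simp [bform_single_right, bform_smul_right, hskr.symm, ← hmid, hsm.symm]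

theorem map_trans {g h : (Fin N → F) ≃ₗ[F] (Fin N → F)} (W : Submodule F (Fin N → F)) :
    W.map (g.trans h).toLinearMap = (W.map g.toLinearMap).map h.toLinearMap := by
  rw [← Submodule.map_comp]; rfl

/-- The orthogonal group acts transitively on full isotropic flags. -/
theorem exists_orthMap_map_flag_eq (h2 : (2 : F) ≠ 0) {n : ℕ}
    {V : Fin n → Submodule F (Fin (2 * n + 1) → F)} (hmono : Monotone V)
    (hdim : ∀ i, finrank F (V i) = i + 1) (hiso : ∀ i, IsIsotropic F (2 * n + 1) (V i)) :
    ∃ g : (Fin (2 * n + 1) → F) ≃ₗ[F] (Fin (2 * n + 1) → F), IsOrthMap F (2 * n + 1) g ∧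
      ∀ i, (V i).map g.toLinearMap
        = coordSub F (Set.Iic (Fin.castLE (by omega : n ≤ 2 * n + 1) i)) := by
  have hn : n ≤ 2 * n + 1 := by omega
  have key : ∀ m ≤ n, ∃ g : (Fin (2 * n + 1) → F) ≃ₗ[F] (Fin (2 * n + 1) → F),
      IsOrthMap F (2 * n + 1) g ∧ ∀ i : Fin n, i.val < m →
        Pi.single (Fin.castLE hn i) 1 ∈ (V i).map g.toLinearMap := by
    intro m
    induction m with
    | zero => exact fun _ => ⟨LinearEquiv.refl F _, fun _ _ => rfl, by simp⟩
    | succ m ih =>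
      intro hm
      obtain ⟨g, hg, hgV⟩ := ih (by omega)
      set i₀ : Fin n := ⟨m, hm⟩ with hi₀
      set k := Fin.castLE hn i₀ with hk
      have hkval : k.val = m := rfl
      have hW := (hiso i₀).map hg
      have hTW : ∀ s, s < k → Pi.single s 1 ∈ (V i₀).map g.toLinearMap := by
        intro s hs
        have hsm : s.val < m := hs
        exact Submodule.map_mono (hmono (show (⟨s.val, by omega⟩ : Fin n) ≤ i₀ from hsm.le))
          (hgV ⟨s.val, by omega⟩ hsm)
      obtain ⟨u, huW, hu0, hus⟩ := exists_mem_ne_zero_of_card_lt (T := Finset.Iio k)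
        (W := (V i₀).map g.toLinearMap) (by
          rw [LinearEquiv.finrank_map_eq, hdim, Fin.card_Iio, hkval, hi₀]
          exact Nat.lt_succ_self m)
      have huu := hW u huW u huW
      have hkr : k ≠ k.rev := by
        intro h
        have := congrArg Fin.val h
        rw [Fin.val_rev] at this
        omega
      let mid : Fin (2 * n + 1) := ⟨n, by omega⟩
      have hmid : mid = mid.rev := by
        ext
        rw [Fin.val_rev]
        simp only [mid]
        omega
      obtain ⟨g₁, hg₁, hg₁u, hg₁s⟩ := exists_orthMap_apply_ne_zero h2 hmid huu hu0 hkr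
      have hfix : ∀ s, s < k → g₁ (Pi.single s 1) = Pi.single s 1 := by
        intro s hs
        have hsm : s.val < m := hs
        refine hg₁s s (hus s (by simpa using hs)) hs.ne (fun h => ?_) (fun h => ?_)
        · have := congrArg Fin.val h
          rw [Fin.val_rev] at this
          omega
        · have := congrArg Fin.val h
          simp only [mid] at this
          omega
      obtain ⟨h, hh, hhu, hhs, -⟩ := exists_orthMap_apply_eq_single h2 (u := g₁ u)
        (by rw [hg₁, huu]) hkr hg₁u
      refine ⟨(g.trans g₁).trans h, (hg.trans hg₁).trans hh, fun i hi => ?_⟩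
      rw [map_trans, map_trans]
      rcases Nat.lt_succ_iff_lt_or_eq.1 hi with hi | hi
      · have hik : Fin.castLE hn i < k := hi
        refine ⟨_, ⟨_, hgV i hi, hfix _ hik⟩, hhs _ ?_ hik.ne⟩
        rw [← bform_single_right (g₁ u), ← hfix _ hik, hg₁, bform_single_right]
        exact hW.apply_rev_eq_zero huW (hTW _ hik)
      · obtain rfl : i = i₀ := Fin.ext hi
        refine ⟨(g₁ u k)⁻¹ • g₁ u, Submodule.smul_mem _ _ ⟨u, huW, rfl⟩, ?_⟩
        change h _ = _
        rw [map_smul, hhu, smul_smul, inv_mul_cancel₀ hg₁u, one_smul]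
  obtain ⟨g, hg, hgV⟩ := key n le_rfl
  refine ⟨g, hg, fun i => ?_⟩
  rw [← Finset.coe_Iic]
  refine eq_coordSub (fun s hs => ?_) (by
    rw [LinearEquiv.finrank_map_eq, hdim, Fin.card_Iic]; rfl)
  have hsi : s.val ≤ i.val := (Finset.mem_Iic.1 hs : s ≤ _)
  exact Submodule.map_mono (hmono (show (⟨s.val, by omega⟩ : Fin n) ≤ i from hsi))
    (hgV ⟨s.val, by omega⟩ (show s.val < n by omega))

/-- `g` is orthogonal and stabilizes the standard flag and the coordinate subspace of `S`. -/
structure IsStab (S : Finset (Fin N)) (g : (Fin N → F) ≃ₗ[F] (Fin N → F)) : Prop where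
  isOrthMap : IsOrthMap F N g
  isUpper : IsUpper g
  mem_coordSub : ∀ x ∈ coordSub F (S : Set (Fin N)), g x ∈ coordSub F (S : Set (Fin N))

theorem IsStab.refl (S : Finset (Fin N)) : IsStab S (LinearEquiv.refl F (Fin N → F)) :=
  ⟨fun _ _ => rfl, fun _ _ hx => hx, fun _ hx => hx⟩

theorem IsStab.trans {S : Finset (Fin N)} {g h : (Fin N → F) ≃ₗ[F] (Fin N → F)}
    (hg : IsStab S g) (hh : IsStab S h) : IsStab S (g.trans h) :=
  ⟨hg.1.trans hh.1, hg.2.trans hh.2, fun x hx => hh.3 _ (hg.3 x hx)⟩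

theorem exists_isStab_root (h2 : (2 : F) ≠ 0) {S : Finset (Fin N)} (hS : ∀ s ∈ S, s.rev ∉ S)
    {i k : Fin N} (hik : i < k) (hi : i ≠ i.rev) (hikr : i ≠ k.rev) (hkS : k ∈ S → i ∈ S)
    (hiS : i.rev ∈ S → k.rev ∈ S) (t : F) :
    ∃ g : (Fin N → F) ≃ₗ[F] (Fin N → F), IsStab S g ∧ ∀ x,
      g x k.rev = x k.rev - t * x i.rev ∧ ∀ j, j ≠ i → j ≠ k.rev → g x j = x j := by
  obtain ⟨g, hg, hgx⟩ := exists_siegel h2 (Pi.single i 1) (t • Pi.single k.rev 1 : Fin N → F)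
    (by rw [bform_single_right]; simp [hi.symm])
    (by
      have : i.rev ≠ k.rev := fun h => hik.ne (Fin.rev_injective h)
      rw [bform_single_right]; simp [this])
  have hrev : k.rev < i.rev := Fin.rev_lt_rev.2 hik
  have hgi : ∀ x, (k = k.rev → x i.rev = 0) → x k = 0 → g x i = x i := by
    intro x h1 h3
    rw [hgx]
    by_cases hk : k = k.rev
    · simp [bform_single_right, bform_smul_right, h1 hk, h3]
    · simp [bform_single_right, bform_smul_right, h3, hk, hikr]
  have hgk : ∀ x, g x k.rev = x k.rev - t * x i.rev := by
    intro x
    rw [hgx]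
    simp [bform_single_right, hikr.symm, mul_comm]
  have hgj : ∀ x j, j ≠ i → j ≠ k.rev → g x j = x j := by
    intro x j h1 h3
    rw [hgx]
    simp [h1, h3]
  refine ⟨g, ⟨hg, fun m x hx j hj => ?_, fun x hx j hj => ?_⟩, fun x => ⟨hgk x, hgj x⟩⟩
  · by_cases hji : j = i
    · subst hji
      rw [hgi x (fun h => hx _ (hj.trans (hik.trans (by rwa [← h] at hrev))))
        (hx _ (hj.trans hik)), hx _ hj]
    · by_cases hjk : j = k.rev
      · rw [hjk, hgk, hx _ (hjk ▸ hj), hx _ ((hjk ▸ hj).trans hrev), mul_zero, sub_zero]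
      · rw [hgj x j hji hjk, hx j hj]
  · by_cases hji : j = i
    · subst hji
      rw [hgi x (fun h => hx _ fun h' => ?_) (hx _ fun h => hj (hkS h)), hx _ hj]
      have h4 := hiS h'
      exact hS _ h4 (by rwa [Fin.rev_rev, h])
    · by_cases hjk : j = k.rev
      · rw [hjk, hgk, hx _ (hjk ▸ hj), hx _ fun h => hj (hjk ▸ hiS h), mul_zero, sub_zero]
      · rw [hgj x j hji hjk, hx j hj]

theorem exists_isStab_torus (S : Finset (Fin N)) (t : Fin N → F)
    (ht : ∀ j, t j * t j.rev = 1) :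
    ∃ g : (Fin N → F) ≃ₗ[F] (Fin N → F), IsStab S g ∧ ∀ x j, g x j = t j * x j := by
  obtain ⟨g, hg, hgx⟩ := exists_orthMap_of_linearMap
    (LinearMap.pi fun j => t j • LinearMap.proj j : (Fin N → F) →ₗ[F] (Fin N → F))
    (fun u v => Finset.sum_congr rfl fun j _ => by
      simp only [LinearMap.pi_apply, LinearMap.smul_apply, LinearMap.proj_apply, smul_eq_mul]
      linear_combination (u j * v j.rev) * ht j)
  have hgx' : ∀ x j, g x j = t j * x j := fun x j => by rw [hgx]; rfl
  exact ⟨g, ⟨hg, fun m x hx j hj => by rw [hgx', hx j hj, mul_zero],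
    fun x hx j hj => by rw [hgx', hx j hj, mul_zero]⟩, hgx'⟩

theorem exists_isStab_reduced (h2 : (2 : F) ≠ 0) {S : Finset (Fin N)}
    (hS : ∀ s ∈ S, s.rev ∉ S) (v : Fin N → F) :
    ∃ g : (Fin N → F) ≃ₗ[F] (Fin N → F), IsStab S g ∧ ∀ i k, i < k → i ≠ i.rev →
      i ≠ k.rev → (k ∈ S → i ∈ S) → (i.rev ∈ S → k.rev ∈ S) → g v i ≠ 0 → g v i.rev ≠ 0 →
        g v k.rev = 0 := by
  classical
  induction hm : (Finset.univ.filter fun j => v j ≠ 0).card using Nat.strong_induction_on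
    generalizing v with
  | _ m ih =>
    subst hm
    by_cases hred : ∀ i k, i < k → i ≠ i.rev → i ≠ k.rev → (k ∈ S → i ∈ S) →
        (i.rev ∈ S → k.rev ∈ S) → v i ≠ 0 → v i.rev ≠ 0 → v k.rev = 0
    · exact ⟨_, IsStab.refl S, hred⟩
    · push Not at hred
      obtain ⟨i, k, hik, hi, hikr, hkS, hiS, hvi, hvir, hvk⟩ := hred
      obtain ⟨g, hg, hgx⟩ :=
        exists_isStab_root h2 hS hik hi hikr hkS hiS (v k.rev / v i.rev)
      obtain ⟨hgk, hgj⟩ := hgx v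
      rw [div_mul_cancel₀ _ hvir, sub_self] at hgk
      have hsub : (Finset.univ.filter fun j => g v j ≠ 0)
          ⊂ Finset.univ.filter fun j => v j ≠ 0 := by
        rw [Finset.ssubset_iff_of_subset]
        · exact ⟨k.rev, by simpa using hvk, by simp [hgk]⟩
        · intro j hj
          simp only [Finset.mem_filter, Finset.mem_univ, true_and] at hj ⊢
          by_cases hji : j = i
          · rwa [hji]
          · by_cases hjk : j = k.rev
            · rwa [hjk]
            · rwa [hgj j hji hjk] at hj
      obtain ⟨h, hh, hhv⟩ := ih _ (Finset.card_lt_card hsub) (g v) rfl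
      exact ⟨g.trans h, hg.trans hh, hhv⟩

theorem bform_self_eq_of_support {w : Fin N → F} {q : Fin N}
    (h : ∀ j, w j * w j.rev ≠ 0 → j = q ∨ j = q.rev) :
    bform F N w w = if q = q.rev then w q * w q.rev else 2 * (w q * w q.rev) := by
  have hsum : bform F N w w = ∑ j ∈ {q, q.rev}, w j * w j.rev := by
    refine (Finset.sum_subset (Finset.subset_univ _) fun j _ hj => ?_).symm
    by_contra hne
    exact hj (by simpa using h j hne)
  rw [hsum]
  split_ifs with hq
  · rw [← hq]; simp [← hq]
  · rw [Finset.sum_pair hq, Fin.rev_rev]; ring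

theorem bform_self_eq_of_support₂ {w : Fin N → F} {p q : Fin N} (hp : p ≠ p.rev) (hpq : p ≠ q)
    (hpq' : p ≠ q.rev) (h : ∀ j, w j * w j.rev ≠ 0 →
      (j = p ∨ j = p.rev) ∨ (j = q ∨ j = q.rev)) :
    bform F N w w = 2 * (w p * w p.rev) +
      if q = q.rev then w q * w q.rev else 2 * (w q * w q.rev) := by
  have hpr : p.rev ≠ q := fun h => hpq' (by rw [← h, Fin.rev_rev])
  have hprr : p.rev ≠ q.rev := fun h => hpq (Fin.rev_injective h)
  have hsum : bform F N w w = ∑ j ∈ {p, p.rev, q, q.rev}, w j * w j.rev := by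
    refine (Finset.sum_subset (Finset.subset_univ _) fun j _ hj => ?_).symm
    by_contra hne
    refine hj ?_
    simpa [or_assoc] using h j hne
  rw [hsum, Finset.sum_insert (by simp [hp, hpq, hpq']),
    Finset.sum_insert (by simp [hpr, hprr]), Fin.rev_rev]
  split_ifs with hq
  · rw [← hq]; simp [← hq]; ring
  · rw [Finset.sum_pair hq, Fin.rev_rev]; ring

/-- The coordinates allowed in a normal form, given square class representatives `R`. -/
def normalCoords (R : Set F) : Set F := {0, 1, -1 / 2} ∪ R ∪ -R

/-- After a scaling, the products of opposite coordinates of a reduced isotropic vector take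
finitely many values. -/
theorem exists_scaling (h2 : (2 : F) ≠ 0) {S : Finset (Fin N)} (hS : ∀ s ∈ S, s.rev ∉ S)
    {R : Set F} (hR : ∀ q : Fin N, q ∉ S → q.rev ∉ S → q ≠ q.rev →
      ∀ c : F, c ≠ 0 → ∃ l : F, l ≠ 0 ∧ l * l * c ∈ R)
    {w : Fin N → F} (hw : bform F N w w = 0)
    (hred : ∀ i k, i < k → i ≠ i.rev → i ≠ k.rev → (k ∈ S → i ∈ S) →
      (i.rev ∈ S → k.rev ∈ S) → w i ≠ 0 → w i.rev ≠ 0 → w k.rev = 0) :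
    ∃ c : F, c ≠ 0 ∧ ∀ j, c * c * (w j * w j.rev) ∈ normalCoords R ∧
      (j = j.rev → c * w j = 0 ∨ c * w j = 1) := by
  have h0 : (0 : F) ∈ normalCoords R := by simp [normalCoords]
  have hlt : ∀ i k, i < k → (k ∈ S ↔ i ∈ S) → (k.rev ∈ S ↔ i.rev ∈ S) →
      w i * w i.rev ≠ 0 → w k * w k.rev ≠ 0 → k = i.rev := by
    intro i k hik h1 h3 hi hk
    by_contra hki
    have hikr : i ≠ k.rev := fun h => hki (by rw [h, Fin.rev_rev])
    by_cases hir : i = i.rev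
    · have hkr : k.rev ≠ k.rev.rev := fun h =>
        hik.ne (eq_of_rev_eq_self hir (by rw [Fin.rev_rev] at h; exact h.symm))
      have := hred k.rev i.rev (Fin.rev_lt_rev.2 hik) hkr
        (by rw [Fin.rev_rev]; exact hikr.symm) h3.2
        (by rw [Fin.rev_rev, Fin.rev_rev]; exact h1.1) (right_ne_zero_of_mul hk)
        (by rw [Fin.rev_rev]; exact left_ne_zero_of_mul hk)
      rw [Fin.rev_rev] at this
      exact left_ne_zero_of_mul hi this
    · exact right_ne_zero_of_mul hk (hred i k hik hir hikr h1.1 h3.2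
        (left_ne_zero_of_mul hi) (right_ne_zero_of_mul hi))
  have hcls : ∀ i k, (k ∈ S ↔ i ∈ S) → (k.rev ∈ S ↔ i.rev ∈ S) →
      w i * w i.rev ≠ 0 → w k * w k.rev ≠ 0 → k = i ∨ k = i.rev := by
    intro i k h1 h3 hi hk
    rcases lt_trichotomy i k with h | h | h
    · exact Or.inr (hlt i k h h1 h3 hi hk)
    · exact Or.inl h.symm
    · right
      rw [hlt k i h h1.symm h3.symm hk hi, Fin.rev_rev]
  have hsymm : ∀ j, w j * w j.rev ≠ 0 → w j.rev * w j.rev.rev ≠ 0 := by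
    intro j hj
    rwa [Fin.rev_rev, mul_comm]
  have hSp : ∀ p ∈ S, w p * w p.rev ≠ 0 → ∀ j, w j * w j.rev ≠ 0 → (j ∈ S ∨ j.rev ∈ S) →
      j = p ∨ j = p.rev := by
    intro p hp hwp j hwj hj
    rcases hj with hj | hj
    · exact hcls p j (by simp [hp, hj]) (by simp [hS p hp, hS j hj]) hwp hwj
    · have := hcls p j.rev (by simp [hp, hj])
        (iff_of_false (by rw [Fin.rev_rev]; exact fun h => hS j h hj) (hS p hp)) hwp (hsymm j hwj)
      rcases this with h | h
      · right; rw [← h, Fin.rev_rev]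
      · left; exact Fin.rev_injective h
  have hMq : ∀ q, q ∉ S → q.rev ∉ S → w q * w q.rev ≠ 0 → ∀ j, w j * w j.rev ≠ 0 →
      ¬ (j ∈ S ∨ j.rev ∈ S) → j = q ∨ j = q.rev := by
    intro q hq hq' hwq j hwj hj
    push Not at hj
    exact hcls q j (by simp [hq, hj]) (by simp [hq', hj]) hwq hwj
  have hsingle : ∀ q, w q * w q.rev ≠ 0 → ¬ ∀ j, w j * w j.rev ≠ 0 → j = q ∨ j = q.rev := by
    intro q hq h
    have := bform_self_eq_of_support h
    rw [hw] at this
    split_ifs at this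
    · exact hq this.symm
    · exact mul_ne_zero h2 hq this.symm
  by_cases hA : ∃ p, (p ∈ S ∨ p.rev ∈ S) ∧ w p * w p.rev ≠ 0
  swap
  · have hnone : ∀ j, w j * w j.rev = 0 := by
      by_contra! h
      obtain ⟨q, hq⟩ := h
      have hM : ∀ j, w j * w j.rev ≠ 0 → ¬ (j ∈ S ∨ j.rev ∈ S) := fun j h h' => hA ⟨j, h', h⟩
      have hqM := hM q hq
      push Not at hqM
      exact hsingle q hq fun j hj => hMq q hqM.1 hqM.2 hq j hj (hM j hj)
    refine ⟨1, one_ne_zero, fun j => ⟨by rw [hnone, mul_zero]; exact h0, fun hj => ?_⟩⟩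
    have := hnone j
    rw [← hj, mul_self_eq_zero] at this
    exact Or.inl (by rw [this, mul_zero])
  have hA' : ∃ p ∈ S, w p * w p.rev ≠ 0 := by
    obtain ⟨p, hp | hp, hwp⟩ := hA
    · exact ⟨p, hp, hwp⟩
    · exact ⟨p.rev, hp, hsymm p hwp⟩
  obtain ⟨p, hp, hwp⟩ := hA'
  have hB : ∃ q, ¬ (q ∈ S ∨ q.rev ∈ S) ∧ w q * w q.rev ≠ 0 := by
    by_contra! h
    refine hsingle p hwp fun j hj => hSp p hp hwp j hj ?_
    by_contra h'
    exact hj (h j (not_or.1 h'))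
  obtain ⟨q, hqM, hwq⟩ := hB
  have hqM' := hqM
  push Not at hqM'
  have hall : ∀ j, w j * w j.rev ≠ 0 → (j = p ∨ j = p.rev) ∨ (j = q ∨ j = q.rev) := by
    intro j hj
    by_cases h : j ∈ S ∨ j.rev ∈ S
    · exact Or.inl (hSp p hp hwp j hj h)
    · exact Or.inr (hMq q hqM'.1 hqM'.2 hwq j hj h)
  have hpr : p ≠ p.rev := fun h => hS p hp (h ▸ hp)
  have hsum := bform_self_eq_of_support₂ (q := q) hpr (fun h => hqM'.1 (h ▸ hp))
    (fun h => hqM'.2 (h ▸ hp)) hall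
  rw [hw] at hsum
  have hmem : ∀ c : F, c * c * (w p * w p.rev) ∈ normalCoords R →
      c * c * (w q * w q.rev) ∈ normalCoords R →
      ∀ j, c * c * (w j * w j.rev) ∈ normalCoords R := by
    intro c h1 h3 j
    by_cases hj : w j * w j.rev = 0
    · rw [hj, mul_zero]; exact h0
    · rcases hall j hj with (rfl | rfl) | (rfl | rfl)
      · exact h1
      · rwa [Fin.rev_rev, mul_comm (w p.rev)]
      · exact h3
      · rwa [Fin.rev_rev, mul_comm (w q.rev)]
  by_cases hq : q = q.rev
  · rw [if_pos hq, ← hq] at hsum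
    have hwq0 : w q ≠ 0 := left_ne_zero_of_mul hwq
    refine ⟨(w q)⁻¹, inv_ne_zero hwq0, fun j => ⟨hmem _ ?_ ?_ j, fun hj => Or.inr ?_⟩⟩
    · have : (w q)⁻¹ * (w q)⁻¹ * (w p * w p.rev) = -1 / 2 := by
        field_simp
        linear_combination -hsum
      rw [this]
      simp [normalCoords]
    · have : (w q)⁻¹ * (w q)⁻¹ * (w q * w q.rev) = 1 := by
        rw [← hq]
        field_simp
      rw [this]
      simp [normalCoords]
    · rw [eq_of_rev_eq_self hj hq, inv_mul_cancel₀ hwq0]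
  · rw [if_neg hq, ← mul_add] at hsum
    have hpq : w q * w q.rev = -(w p * w p.rev) := by
      have := (mul_eq_zero.1 hsum.symm).resolve_left h2
      linear_combination this
    obtain ⟨l, hl, hlR⟩ := hR q hqM'.1 hqM'.2 hq _ hwp
    refine ⟨l, hl, fun j => ⟨hmem _ (Or.inl (Or.inr hlR)) (Or.inr ?_) j, fun hj => Or.inl ?_⟩⟩
    · rw [hpq]
      simpa using hlR
    · by_contra hne
      have hwj := right_ne_zero_of_mul hne
      rcases hall j (by rw [← hj]; exact mul_ne_zero hwj hwj) with (rfl | rfl) | (rfl | rfl)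
      · exact hpr hj
      · exact hpr (by rw [Fin.rev_rev] at hj; exact hj.symm)
      · exact hq hj
      · exact hq (by rw [Fin.rev_rev] at hj; exact hj.symm)

theorem exists_torus_normalize {C : Set F} (h0 : (0 : F) ∈ C) (h1 : (1 : F) ∈ C)
    {z : Fin N → F} (hz : ∀ j, z j * z j.rev ∈ C) (hz' : ∀ j, j = j.rev → z j ∈ C) :
    ∃ t : Fin N → F, (∀ j, t j * t j.rev = 1) ∧ ∀ j, t j * z j ∈ C := by
  classical
  let s : Fin N → F := fun j =>
    if z j ≠ 0 then (z j)⁻¹ else if z j.rev ≠ 0 then z j.rev else 1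
  have hs : ∀ j, s j ≠ 0 := by
    intro j
    simp only [s]
    split_ifs with h h'
    · exact inv_ne_zero h
    · exact h'
    · exact one_ne_zero
  have hs1 : ∀ j, s j * z j ∈ C := by
    intro j
    simp only [s]
    split_ifs with h h'
    · rwa [inv_mul_cancel₀ h]
    · rwa [not_not.1 h, mul_zero]
    · rwa [not_not.1 h, mul_zero]
  have hs2 : ∀ j, (s j)⁻¹ * z j.rev ∈ C := by
    intro j
    simp only [s]
    split_ifs with h h'
    · rw [inv_inv]; exact hz j
    · rwa [inv_mul_cancel₀ h']
    · rwa [not_not.1 h', mul_zero]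
  refine ⟨fun j => if j < j.rev then s j else if j.rev < j then (s j.rev)⁻¹ else 1,
    fun j => ?_, fun j => ?_⟩
  · rcases lt_trichotomy j j.rev with h | h | h
    · simp [h, h.not_gt, hs]
    · simp [← h]
    · simp [h, h.not_gt, hs]
  · rcases lt_trichotomy j j.rev with h | h | h
    · simpa [h] using hs1 j
    · simpa [← h] using hz' j h
    · simpa [h, h.not_gt] using hs2 j.rev

theorem exists_isStab_normal_form (h2 : (2 : F) ≠ 0) {S : Finset (Fin N)}
    (hS : ∀ s ∈ S, s.rev ∉ S) {R : Set F} (hR : ∀ q : Fin N, q ∉ S → q.rev ∉ S → q ≠ q.rev →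
      ∀ c : F, c ≠ 0 → ∃ l : F, l ≠ 0 ∧ l * l * c ∈ R)
    {v : Fin N → F} (hv : bform F N v v = 0) :
    ∃ g : (Fin N → F) ≃ₗ[F] (Fin N → F), IsStab S g ∧ ∃ c : F, c ≠ 0 ∧
      ∀ j, (c • g v) j ∈ normalCoords R := by
  obtain ⟨g, hg, hred⟩ := exists_isStab_reduced h2 hS v
  obtain ⟨c, hc, hcC⟩ := exists_scaling h2 hS hR (by rw [hg.isOrthMap, hv]) hred
  have h0 : (0 : F) ∈ normalCoords R := by simp [normalCoords]
  have h1 : (1 : F) ∈ normalCoords R := by simp [normalCoords]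
  obtain ⟨t, ht, htC⟩ := exists_torus_normalize (z := c • g v) h0 h1 (fun j => by
    have := (hcC j).1
    convert this using 1
    simp only [Pi.smul_apply, smul_eq_mul]
    ring) (fun j hj => by
    rcases (hcC j).2 hj with h | h
    · simpa [h] using h0
    · simpa [h] using h1)
  obtain ⟨h, hh, hht⟩ := exists_isStab_torus S t ht
  refine ⟨g.trans h, hg.trans hh, c, hc, fun j => ?_⟩
  convert htC j using 1
  simp only [Pi.smul_apply, smul_eq_mul, LinearEquiv.trans_apply, hht]
  ring

theorem exists_finite_square_reps (P : Prop)
    (hC : P → Finite (Fˣ ⧸ (powMonoidHom 2 : Fˣ →* Fˣ).range)) :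
    ∃ R : Set F, R.Finite ∧ (P → ∀ c : F, c ≠ 0 → ∃ l : F, l ≠ 0 ∧ l * l * c ∈ R) := by
  by_cases hP : P
  swap
  · exact ⟨∅, Set.finite_empty, fun h => absurd h hP⟩
  have := hC hP
  refine ⟨Set.range fun x : Fˣ ⧸ (powMonoidHom 2 : Fˣ →* Fˣ).range => ((x.out : Fˣ) : F),
    Set.finite_range _, fun _ c hc => ?_⟩
  obtain ⟨⟨_, l, rfl⟩, hl⟩ :=
    QuotientGroup.mk_out_eq_mul (powMonoidHom 2 : Fˣ →* Fˣ).range (Units.mk0 c hc)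
  refine ⟨l, l.ne_zero, _, (congrArg Units.val hl).trans ?_⟩
  simp [pow_two, mul_comm]

theorem card_lt_of_hyperbolic_pair {n : ℕ} {S : Finset (Fin (2 * n + 1))}
    (hS : ∀ s ∈ S, s.rev ∉ S) {q : Fin (2 * n + 1)} (hq : q ∉ S) (hq' : q.rev ∉ S) (hqr : q ≠ q.rev) : S.card < n := by
  classical
  have hqT : q ∉ S ∪ S.image Fin.rev := by
    simp only [Finset.mem_union, Finset.mem_image, not_or, not_exists, not_and]
    exact ⟨hq, fun s hs h => hq' (by rwa [← h, Fin.rev_rev])⟩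
  have hqT' : q.rev ∉ S ∪ S.image Fin.rev := by
    simp only [Finset.mem_union, Finset.mem_image, not_or, not_exists, not_and]
    exact ⟨hq', fun s hs h => hq (by rwa [← Fin.rev_injective h])⟩
  have hdisj : Disjoint S (S.image Fin.rev) := by
    rw [Finset.disjoint_left]
    intro s hs h
    obtain ⟨r, hr, rfl⟩ := Finset.mem_image.1 h
    exact hS r hr hs
  have hcard : (insert q (insert q.rev (S ∪ S.image Fin.rev))).card = 2 * S.card + 2 := by
    rw [Finset.card_insert_of_notMem (by simp only [Finset.mem_insert, not_or]; exact ⟨hqr, hqT⟩),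
      Finset.card_insert_of_notMem hqT', Finset.card_union_of_disjoint hdisj,
      Finset.card_image_of_injective _ Fin.rev_injective]
    omega
  have := Finset.card_le_univ (insert q (insert q.rev (S ∪ S.image Fin.rev)))
  rw [hcard, Fintype.card_fin] at this
  omega

/-- The triple `x` can be moved to the standard flag, the coordinate subspace `U_S` and the line
spanned by `w`. -/
def HasNormalForm {n α : ℕ}
    (x : FlagVar F n 1 ![α] × FlagVar F n 1 ![1] × FlagVar F n n (fun _ => 1))
    (S : Finset (Fin (2 * n + 1))) (w : Fin (2 * n + 1) → F) : Prop :=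
  ∃ g : (Fin (2 * n + 1) → F) ≃ₗ[F] (Fin (2 * n + 1) → F), IsOrthMap F (2 * n + 1) g ∧
    (x.1.1 0).map g.toLinearMap = coordSub F (S : Set (Fin (2 * n + 1))) ∧
    (x.2.1.1 0).map g.toLinearMap = Submodule.span F {w} ∧
    ∀ i, (x.2.2.1 i).map g.toLinearMap
      = coordSub F (Set.Iic (Fin.castLE (by omega : n ≤ 2 * n + 1) i))

theorem map_symm_trans_eq {g h : (Fin N → F) ≃ₗ[F] (Fin N → F)}
    {V W : Submodule F (Fin N → F)} (hVW : V.map g.toLinearMap = W.map h.toLinearMap) :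
    V.map (g.trans h.symm).toLinearMap = W := by
  rw [map_trans, hVW, ← map_trans, LinearEquiv.self_trans_symm]
  exact Submodule.map_id W

theorem HasNormalForm.tripleRel {n α : ℕ}
    {x y : FlagVar F n 1 ![α] × FlagVar F n 1 ![1] × FlagVar F n n (fun _ => 1)}
    {S : Finset (Fin (2 * n + 1))} {w : Fin (2 * n + 1) → F}
    (hx : HasNormalForm x S w) (hy : HasNormalForm y S w) :
    TripleRel F n 1 1 n ![α] ![1] (fun _ => 1) x y := by
  obtain ⟨g, hg, hg1, hg2, hg3⟩ := hx
  obtain ⟨h, hh, hh1, hh2, hh3⟩ := hy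
  refine ⟨g.trans h.symm, hg.trans hh.symm, fun i => ?_, fun i => ?_, fun i => ?_⟩
  · rw [Subsingleton.elim i 0]
    exact map_symm_trans_eq (hg1.trans hh1.symm)
  · rw [Subsingleton.elim i 0]
    exact map_symm_trans_eq (hg2.trans hh2.symm)
  · exact map_symm_trans_eq ((hg3 i).trans (hh3 i).symm)

theorem exists_hasNormalForm (h2 : (2 : F) ≠ 0) {n α : ℕ} {R : Set F}
    (hR : α < n → ∀ c : F, c ≠ 0 → ∃ l : F, l ≠ 0 ∧ l * l * c ∈ R)
    (x : FlagVar F n 1 ![α] × FlagVar F n 1 ![1] × FlagVar F n n (fun _ => 1)) :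
    ∃ (S : Finset (Fin (2 * n + 1))) (w : Fin (2 * n + 1) → normalCoords R),
      HasNormalForm x S fun j => w j := by
  obtain ⟨⟨U, -, hUdim, hUiso⟩, ⟨L, -, hLdim, hLiso⟩, ⟨V, hVmono, hVdim, hViso⟩⟩ := x
  obtain ⟨g₁, hg₁, hg₁V⟩ := exists_orthMap_map_flag_eq h2 hVmono
    (fun i => by rw [hVdim]; simp [Fin.card_Iic]) hViso
  obtain ⟨g₂, S, hg₂, hg₂u, hScard, hg₂U⟩ := exists_isUpper_map_eq_coordSub h2
    ((hUiso 0).map hg₁)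
  have hUα : S.card = α := by
    rw [hScard, LinearEquiv.finrank_map_eq, hUdim]
    simp
  have hSrev : ∀ s ∈ S, s.rev ∉ S := by
    intro s hs hs'
    have hmem : ∀ r ∈ S, (Pi.single r 1 : Fin (2 * n + 1) → F) ∈ coordSub F (S : Set _) := by
      intro r hr j hj
      have : j ≠ r := fun h => hj (by simpa [h] using hr)
      simp [this]
    rw [← hg₂U] at hmem
    have := (((hUiso 0).map hg₁).map hg₂) _ (hmem s hs) _ (hmem _ hs')
    rw [bform_single_right, Fin.rev_rev] at this
    simp at this
  obtain ⟨v, -, hvL⟩ := finrank_eq_one_iff'.1 (show finrank F (L 0) = 1 by rw [hLdim]; simp)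
  have hLv : L 0 = Submodule.span F {v.1} := by
    apply le_antisymm
    · intro u hu
      obtain ⟨c, hc⟩ := hvL ⟨u, hu⟩
      exact Submodule.mem_span_singleton.2 ⟨c, congrArg Subtype.val hc⟩
    · rw [Submodule.span_singleton_le_iff_mem]
      exact v.2
  obtain ⟨g₃, hg₃, c, hc, hcR⟩ := exists_isStab_normal_form h2 hSrev (R := R)
    (fun q hq hq' hqr => hR (hUα ▸ card_lt_of_hyperbolic_pair hSrev hq hq' hqr))
    (v := g₂ (g₁ v)) (by rw [hg₂, hg₁]; exact hLiso 0 _ v.2 _ v.2)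
  refine ⟨S, fun j => ⟨_, hcR j⟩, (g₁.trans g₂).trans g₃, (hg₁.trans hg₂).trans hg₃.1,
    ?_, ?_, fun i => ?_⟩
  · rw [map_trans, map_trans, hg₂U]
    exact map_coordSub_eq hg₃.3
  · change (L 0).map _ = Submodule.span F {c • g₃ (g₂ (g₁ v))}
    rw [Submodule.span_singleton_smul_eq (IsUnit.mk0 c hc)]
    refine (congrArg (Submodule.map _) hLv).trans ?_
    rw [Submodule.map_span, Set.image_singleton]
    rfl
  · rw [map_trans, map_trans, hg₁V, hg₂u.map_coordSub_Iic, hg₃.2.map_coordSub_Iic]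

end OrthogonalOrbits

/-- for `1 ≤ α ≤ n`, assuming `F^×/(F^×)^2` is finite whenever
`α < n`, the triple flag variety `M_{(α)} × M_{(1)} × M_{(1^n)}` has finitely many
`O_{2n+1}(F)`-orbits. -/
theorem statement18 (F : Type*) [Field F] (hchar : (2 : F) ≠ 0)
    (n : ℕ) (hn : 1 ≤ n) (α : ℕ) (hα1 : 1 ≤ α) (hαn : α ≤ n)
    (hC : α < n → Finite (Fˣ ⧸ (powMonoidHom 2 : Fˣ →* Fˣ).range)) :
    Finite (Quot (TripleRel F n 1 1 n ![α] ![1] (fun _ => 1))) := by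
  obtain ⟨R, hRfin, hR⟩ := exists_finite_square_reps (α < n) hC
  have hfin : (normalCoords R).Finite :=
    ((Set.toFinite _).union hRfin).union hRfin.neg
  have := hfin.to_subtype
  choose S w hx using fun x => exists_hasNormalForm (α := α) hchar hR x
  refine Finite.of_injective (β := Finset (Fin (2 * n + 1)) × (Fin (2 * n + 1) → normalCoords R))
    (fun o => (S o.out, w o.out)) fun o o' h => ?_
  obtain ⟨hS, hw⟩ := Prod.mk.inj h
  rw [← o.out_eq, ← o'.out_eq]
  refine Quot.sound ((hx o.out).tripleRel ?_)
  rw [hS, hw]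
  exact hx o'.out
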